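/- arXiv:1310.8090 — 3 statements merged into one kernel-verified Lean document; each statement's English description precedes it below -/
import Mathlib

section
/- Let n ≥ 0 and k ≥ 1 be integers, and let φ : C(k) → {0,1,…,n} be a map such that (i) if x ∈ C_i^-(k) then φ(x) < i, and (ii) if x ∈ C_i^+(k) then φ(x) ≠ i−1. Then the number N of n-simplices S ⊆ C(k) with φ(S) = {0,1,…,n} (full n-simplices) is odd; in particular it is nonzero. -/
/-- The combinatorial `n`-cube `C(k) = [0,1]^n ∩ (k⁻¹ℤ)^n`. -/
def combCube (n k : ℕ) : Set (Fin n → ℝ) :=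
  {x | ∀ i, x i ∈ Set.Icc (0 : ℝ) 1 ∧ ∃ m : ℤ, x i = (m : ℝ) / k}

/-- The vector `e_i ∈ (k⁻¹ℤ)^n`: all coordinates zero except the `i`-th, which is `1/k`. -/
noncomputable def stdVec (n k : ℕ) (i : Fin n) : Fin n → ℝ :=
  fun j => if j = i then (1 : ℝ) / k else 0

/-- An `n`-simplex in `(k⁻¹ℤ)^n`: an ordered tuple `[z_0,…,z_n]` of points of `(k⁻¹ℤ)^n`
with `z_j = z_{j-1} + e_{α(j)}` for `j = 1,…,n`, where `α` is a permutation of `{1,…,n}`. -/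
def IsNSimplex (n k : ℕ) (z : Fin (n + 1) → Fin n → ℝ) : Prop :=
  (∀ j i, ∃ m : ℤ, z j i = (m : ℝ) / k) ∧
  ∃ α : Equiv.Perm (Fin n), ∀ j : Fin n, z j.succ = z j.castSucc + stdVec n k (α j)

/-- The `j`-th vertex of the lattice simplex with first vertex `x`, in which the coordinate `c`
is increased at step `β c`. -/
def kuhnVertex {n : ℕ} (x β : Fin n → ℕ) (j : ℕ) : Fin n → ℕ :=
  fun c => x c + if β c < j then 1 else 0

open Finset Classical in
/-- Codes `(x, β)` of the simplices contained in the cube `{0, …, k}^n`. -/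
noncomputable def kuhnCodes (n k : ℕ) : Finset ((Fin n → ℕ) × (Fin n → ℕ)) :=
  ((Fintype.piFinset fun _ => range k) ×ˢ (Fintype.piFinset fun _ => range n)).filter
    fun p => Function.Injective p.2

/-- All labels `0, …, n` occur among the vertices of the simplex. -/
def KuhnFull {n : ℕ} (ψ : (Fin n → ℕ) → ℕ) (p : (Fin n → ℕ) × (Fin n → ℕ)) : Prop :=
  ∀ l ≤ n, ∃ i ≤ n, ψ (kuhnVertex p.1 p.2 i) = l

/-- All labels `0, …, n - 1` occur on the facet opposite to the `j`-th vertex. -/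
def KuhnFacetFull {n : ℕ} (ψ : (Fin n → ℕ) → ℕ) (p : (Fin n → ℕ) × (Fin n → ℕ)) (j : ℕ) : Prop :=
  ∀ l < n, ∃ i ≤ n, i ≠ j ∧ ψ (kuhnVertex p.1 p.2 i) = l

lemma mem_kuhnCodes {n k : ℕ} {p : (Fin n → ℕ) × (Fin n → ℕ)} :
    p ∈ kuhnCodes n k ↔ (∀ c, p.1 c < k) ∧ (∀ c, p.2 c < n) ∧ Function.Injective p.2 := by
  simp [kuhnCodes, and_assoc]

lemma kuhnVertex_le {n k : ℕ} {p : (Fin n → ℕ) × (Fin n → ℕ)} (hp : p ∈ kuhnCodes n k)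
    (j : ℕ) (c : Fin n) : kuhnVertex p.1 p.2 j c ≤ k := by
  have := (mem_kuhnCodes.1 hp).1 c
  unfold kuhnVertex
  split_ifs <;> omega

lemma exists_eq_of_injective_lt {n : ℕ} {β : Fin n → ℕ} (hlt : ∀ c, β c < n)
    (hinj : Function.Injective β) {b : ℕ} (hb : b < n) : ∃ c, β c = b := by
  have h : Function.Injective fun c => (⟨β c, hlt c⟩ : Fin n) := fun a b hab =>
    hinj (by simpa using hab)
  obtain ⟨c, hc⟩ := Finite.surjective_of_injective h ⟨b, hb⟩
  exact ⟨c, by simpa using hc⟩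

open Finset in
/-- A function on `{i ≤ n, i ≠ j}` onto `{0, …, n - 1}` is injective. -/
lemma injOn_of_forall_exists_ne {n : ℕ} {f : ℕ → ℕ} {j : ℕ} (hj : j ≤ n)
    (h : ∀ l < n, ∃ i ≤ n, i ≠ j ∧ f i = l) {a b : ℕ} (ha : a ≤ n) (hb : b ≤ n)
    (haj : a ≠ j) (hbj : b ≠ j) (hab : f a = f b) : a = b := by
  have hsub : range n ⊆ ((range (n + 1)).erase j).image f := by
    intro l hl
    obtain ⟨i, hi, hij, rfl⟩ := h l (mem_range.1 hl)
    exact mem_image_of_mem f (by simp; omega)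
  have hcard : ((range (n + 1)).erase j).card = n := by
    rw [card_erase_of_mem (by simp; omega)]; simp
  have hc := card_le_card hsub
  rw [card_range] at hc
  have hinj : Set.InjOn f ((range (n + 1)).erase j) := by
    apply injOn_of_card_image_eq
    have := card_image_le (s := (range (n + 1)).erase j) (f := f)
    omega
  exact hinj (by simp; omega) (by simp; omega) hab

open Finset Classical in
/-- A labelling of `{0, …, n}` is onto `{0, …, n}` iff an odd number of its restrictions to
`{0, …, n} \ {j}` are onto `{0, …, n - 1}`; stated modulo two. -/
lemma card_filter_facet_cast (n : ℕ) (f : ℕ → ℕ) (hf : ∀ i ≤ n, f i ≤ n) :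
    (((range (n + 1)).filter fun j => ∀ l < n, ∃ i ≤ n, i ≠ j ∧ f i = l).card : ZMod 2) =
      if ∀ l ≤ n, ∃ i ≤ n, f i = l then 1 else 0 := by
  set T := (range (n + 1)).filter fun j => ∀ l < n, ∃ i ≤ n, i ≠ j ∧ f i = l with hT
  have memT : ∀ j, j ∈ T ↔ j ≤ n ∧ ∀ l < n, ∃ i ≤ n, i ≠ j ∧ f i = l := by
    intro j; simp [hT]
  split_ifs with hfull
  · obtain ⟨j₀, hj₀, hfj₀⟩ := hfull n le_rfl
    have : T = {j₀} := by
      ext j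
      rw [memT, mem_singleton]
      constructor
      · rintro ⟨hj, h⟩
        by_contra hne
        have hs : range (n + 1) ⊆ ((range (n + 1)).erase j).image f := by
          intro l hl
          rcases lt_or_eq_of_le (Nat.lt_succ_iff.1 (mem_range.1 hl)) with hl | rfl
          · obtain ⟨i, hi, hij, rfl⟩ := h l hl
            exact mem_image_of_mem f (by simp; omega)
          · exact mem_image.2 ⟨j₀, by simp; omega, hfj₀⟩
        have h1 := card_le_card hs
        have h2 := card_image_le (s := (range (n + 1)).erase j) (f := f)
        rw [card_erase_of_mem (by simp; omega)] at h2
        simp at h1 h2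
        omega
      · rintro rfl
        refine ⟨hj₀, fun l hl => ?_⟩
        obtain ⟨i, hi, rfl⟩ := hfull l hl.le
        exact ⟨i, hi, by rintro rfl; omega, rfl⟩
    rw [this]; simp
  · rcases T.eq_empty_or_nonempty with h0 | ⟨j₀, hj₀⟩
    · rw [h0]; simp
    · obtain ⟨hj₀n, h⟩ := (memT j₀).1 hj₀
      have hlt : f j₀ < n := by
        refine lt_of_le_of_ne (hf _ hj₀n) fun heq => hfull fun l hl => ?_
        rcases lt_or_eq_of_le hl with hl | rfl
        · obtain ⟨i, hi, -, hfi⟩ := h l hl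
          exact ⟨i, hi, hfi⟩
        · exact ⟨j₀, hj₀n, heq⟩
      obtain ⟨j₁, hj₁n, hne, hj₁⟩ := h _ hlt
      have : T = {j₀, j₁} := by
        ext j
        rw [memT, mem_insert, mem_singleton]
        constructor
        · rintro ⟨hj, h'⟩
          by_contra! hcon
          exact hne (injOn_of_forall_exists_ne hj h' hj₁n hj₀n hcon.2.symm hcon.1.symm hj₁)
        · rintro (rfl | rfl)
          · exact ⟨hj₀n, h⟩
          · refine ⟨hj₁n, fun l hl => ?_⟩
            obtain ⟨i, hi, hij, hfi⟩ := h l hl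
            by_cases hij1 : i = j
            · exact ⟨j₀, hj₀n, hne.symm, by rw [← hfi, hij1, hj₁]⟩
            · exact ⟨i, hi, hij1, hfi⟩
      rw [this, card_pair hne.symm]
      rfl

/-- The other simplex code having the same facet opposite to the `j`-th vertex. -/
def kuhnFlip {m : ℕ} (t : ((Fin (m + 1) → ℕ) × (Fin (m + 1) → ℕ)) × ℕ) :
    ((Fin (m + 1) → ℕ) × (Fin (m + 1) → ℕ)) × ℕ :=
  if t.2 = 0 then
    ((fun c => t.1.1 c + if t.1.2 c = 0 then 1 else 0,
      fun c => if t.1.2 c = 0 then m else t.1.2 c - 1), m + 1)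
  else if t.2 = m + 1 then
    ((fun c => t.1.1 c - if t.1.2 c = m then 1 else 0,
      fun c => if t.1.2 c = m then 0 else t.1.2 c + 1), 0)
  else
    ((t.1.1, fun c => if t.1.2 c = t.2 then t.2 - 1 else if t.1.2 c + 1 = t.2 then t.2
      else t.1.2 c), t.2)

/-- The facet lies in the face of the cube where the last coordinate vanishes. -/
def KuhnBottom {m : ℕ} (t : ((Fin (m + 1) → ℕ) × (Fin (m + 1) → ℕ)) × ℕ) : Prop :=
  t.2 = m + 1 ∧ t.1.1 (Fin.last m) = 0 ∧ t.1.2 (Fin.last m) = m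

section Step

variable {m k : ℕ} {ψ : (Fin (m + 1) → ℕ) → ℕ} {x β : Fin (m + 1) → ℕ} {j : ℕ}

lemma add_one_lt_of_facetFull_zero (hψ : ∀ y, (∀ c, y c ≤ k) → ∀ c, y c = k → ψ y ≠ c.val)
    (hp : (x, β) ∈ kuhnCodes (m + 1) k) (h : KuhnFacetFull ψ (x, β) 0) {c : Fin (m + 1)}
    (hc : β c = 0) : x c + 1 < k := by
  by_contra hcon
  obtain ⟨i, -, hi0, hi⟩ := h c c.isLt
  refine hψ _ (kuhnVertex_le hp i) c ?_ hi
  have hx := (mem_kuhnCodes.1 hp).1 c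
  simp only at hx
  simp only [kuhnVertex, hc]
  rw [if_pos (by omega)]
  omega

lemma pos_of_facetFull_last (hψ : ∀ y, (∀ c, y c ≤ k) → ∀ c, y c = 0 → ψ y < c.val + 1)
    (hp : (x, β) ∈ kuhnCodes (m + 1) k) (h : KuhnFacetFull ψ (x, β) (m + 1))
    (hb : ¬ KuhnBottom ((x, β), m + 1)) {c : Fin (m + 1)} (hc : β c = m) : 0 < x c := by
  by_contra hcon
  have hx0 : x c = 0 := by omega
  obtain ⟨i, hile, hi0, hi⟩ := h m (by omega)
  have := hψ _ (kuhnVertex_le hp i) c (by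
    simp only [kuhnVertex, hc, hx0]
    rw [if_neg (by omega)])
  have hcm : c = Fin.last m := by
    apply Fin.ext
    have := c.isLt
    simp only [Fin.val_last]
    omega
  exact hb ⟨rfl, hcm ▸ hx0, hcm ▸ hc⟩

lemma kuhnFlip_mem (h₀ : ∀ y, (∀ c, y c ≤ k) → ∀ c, y c = 0 → ψ y < c.val + 1)
    (h₁ : ∀ y, (∀ c, y c ≤ k) → ∀ c, y c = k → ψ y ≠ c.val)
    (hp : (x, β) ∈ kuhnCodes (m + 1) k) (hj : j ≤ m + 1) (h : KuhnFacetFull ψ (x, β) j)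
    (hb : ¬ KuhnBottom ((x, β), j)) :
    (kuhnFlip ((x, β), j)).1 ∈ kuhnCodes (m + 1) k ∧ (kuhnFlip ((x, β), j)).2 ≤ m + 1 ∧
      KuhnFacetFull ψ (kuhnFlip ((x, β), j)).1 (kuhnFlip ((x, β), j)).2 ∧
      ¬ KuhnBottom (kuhnFlip ((x, β), j)) ∧
      kuhnFlip (kuhnFlip ((x, β), j)) = ((x, β), j) ∧ kuhnFlip ((x, β), j) ≠ ((x, β), j) := by
  obtain ⟨hx, hβ, hinj⟩ := mem_kuhnCodes.1 hp
  simp only at hx hβ hinj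
  by_cases hj0 : j = 0
  · subst hj0
    have hflip : kuhnFlip ((x, β), 0) = ((fun c => x c + if β c = 0 then 1 else 0,
        fun c => if β c = 0 then m else β c - 1), m + 1) := by simp [kuhnFlip]
    rw [hflip]
    refine ⟨mem_kuhnCodes.2 ⟨fun c => ?_, fun c => ?_, fun a b hab => ?_⟩, le_rfl, ?_, ?_, ?_, ?_⟩
    · have := hx c
      have := @add_one_lt_of_facetFull_zero _ _ _ _ _ h₁ hp h c
      simp only
      split_ifs <;> grind
    · have := hβ c
      simp only
      split_ifs <;> omega
    · have := hβ a
      have := hβ b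
      apply hinj
      simp only at hab
      split_ifs at hab <;> omega
    · intro l hl
      obtain ⟨i, hi, hi0, hil⟩ := h l hl
      refine ⟨i - 1, by omega, by omega, ?_⟩
      rw [← hil]
      congr 1
      funext c
      have := hβ c
      simp only [kuhnVertex]
      split_ifs <;> omega
    · rintro ⟨-, h1, h2⟩
      have := hβ (Fin.last m)
      simp only at h1 h2
      split_ifs at h1 h2 <;> omega
    · simp only [kuhnFlip, Nat.add_eq_zero_iff, one_ne_zero, and_false, if_false, if_true]
      refine Prod.ext (Prod.ext (funext fun c => ?_) (funext fun c => ?_)) rfl <;>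
        have := hβ c <;> simp only <;> split_ifs <;> omega
    · simp
  by_cases hjm : j = m + 1
  · subst hjm
    have hflip : kuhnFlip ((x, β), m + 1) = ((fun c => x c - if β c = m then 1 else 0,
        fun c => if β c = m then 0 else β c + 1), 0) := by simp [kuhnFlip]
    have hpos := @pos_of_facetFull_last _ _ _ _ _ h₀ hp h hb
    rw [hflip]
    refine ⟨mem_kuhnCodes.2 ⟨fun c => ?_, fun c => ?_, fun a b hab => ?_⟩, by simp, ?_, ?_, ?_, ?_⟩
    · have := hx c
      simp only
      split_ifs <;> omega
    · have := hβ c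
      simp only
      split_ifs <;> omega
    · have := hβ a
      have := hβ b
      apply hinj
      simp only at hab
      split_ifs at hab <;> omega
    · intro l hl
      obtain ⟨i, hi, hi0, hil⟩ := h l hl
      refine ⟨i + 1, by omega, by omega, ?_⟩
      rw [← hil]
      congr 1
      funext c
      have := hβ c
      have := @hpos c
      simp only [kuhnVertex]
      split_ifs <;> grind
    · rintro ⟨h1, -⟩
      simp at h1
    · simp only [kuhnFlip, if_true]
      refine Prod.ext (Prod.ext ?_ ?_) rfl <;> funext c <;> have := hβ c <;> have := @hpos c <;> simp only <;>
        split_ifs <;> grind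
    · simp
  · have hflip : kuhnFlip ((x, β), j) =
        ((x, fun c => if β c = j then j - 1 else if β c + 1 = j then j else β c), j) := by
      simp [kuhnFlip, hj0, hjm]
    rw [hflip]
    refine ⟨mem_kuhnCodes.2 ⟨hx, fun c => ?_, fun a b hab => ?_⟩, hj, ?_, ?_, ?_, ?_⟩
    · have := hβ c
      simp only
      split_ifs <;> omega
    · apply hinj
      simp only at hab
      split_ifs at hab <;> omega
    · intro l hl
      obtain ⟨i, hi, hi0, hil⟩ := h l hl
      refine ⟨i, hi, hi0, ?_⟩
      rw [← hil]
      congr 1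
      funext c
      simp only [kuhnVertex]
      split_ifs <;> omega
    · rintro ⟨h1, -⟩
      exact hjm h1
    · simp only [kuhnFlip, hj0, hjm, if_false, Prod.mk.injEq, true_and, and_true]
      funext c
      split_ifs <;> omega
    · obtain ⟨c, hc⟩ := exists_eq_of_injective_lt hβ hinj (b := j) (by omega)
      intro heq
      have := congrFun (congrArg (fun t => t.1.2) heq) c
      simp only [hc, if_true] at this
      omega

end Step

open Finset Classical in
/-- Kuhn's cubical Sperner lemma on the integer cube `{0, …, k}^n`. -/
lemma odd_card_kuhnFull (n k : ℕ) (hk : 1 ≤ k) (ψ : (Fin n → ℕ) → ℕ)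
    (hψ : ∀ y, (∀ c, y c ≤ k) → ψ y ≤ n)
    (h₀ : ∀ y, (∀ c, y c ≤ k) → ∀ c, y c = 0 → ψ y < c.val + 1)
    (h₁ : ∀ y, (∀ c, y c ≤ k) → ∀ c, y c = k → ψ y ≠ c.val) :
    (((kuhnCodes n k).filter (KuhnFull ψ)).card : ZMod 2) = 1 := by
  induction n with
  | zero =>
    have : (kuhnCodes 0 k).filter (KuhnFull ψ) = {(Fin.elim0, Fin.elim0)} := by
      ext p
      simp only [mem_filter, mem_kuhnCodes, mem_singleton]
      refine ⟨fun _ => Subsingleton.elim _ _, fun _ =>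
        ⟨⟨fun c => c.elim0, fun c => c.elim0, fun c => c.elim0⟩, fun l hl => ⟨0, le_rfl, ?_⟩⟩⟩
      have := hψ (kuhnVertex p.1 p.2 0) fun c => c.elim0
      omega
    rw [this]; simp
  | succ m ih =>
    set T := ((kuhnCodes (m + 1) k) ×ˢ (range (m + 2))).filter
      fun t => KuhnFacetFull ψ t.1 t.2 with hT
    have memT : ∀ t, t ∈ T ↔ t.1 ∈ kuhnCodes (m + 1) k ∧ t.2 ≤ m + 1 ∧
        KuhnFacetFull ψ t.1 t.2 := by
      intro t
      simp [hT, and_assoc, Nat.lt_succ_iff]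
    have hcount : (((kuhnCodes (m + 1) k).filter (KuhnFull ψ)).card : ZMod 2) = T.card := by
      rw [hT, card_filter, card_filter, sum_product]
      push_cast
      refine sum_congr rfl fun p hp => ?_
      have := card_filter_facet_cast (m + 1) (fun i => ψ (kuhnVertex p.1 p.2 i))
        fun i _ => hψ _ (kuhnVertex_le hp i)
      rw [card_filter] at this
      push_cast at this
      unfold KuhnFull KuhnFacetFull
      convert this.symm
    have heven : ((T.filter fun t => ¬ KuhnBottom t).card : ZMod 2) = 0 := by
      rw [card_eq_sum_ones]
      push_cast
      have key : ∀ t ∈ T.filter fun t => ¬ KuhnBottom t, _ := fun t ht => by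
        obtain ⟨ht, hb⟩ := mem_filter.1 ht
        obtain ⟨hp, hj, h⟩ := (memT t).1 ht
        exact kuhnFlip_mem (j := t.2) h₀ h₁ hp hj h hb
      refine sum_involution (fun t _ => kuhnFlip t) (fun _ _ => by decide)
        (fun t ht _ => (key t ht).2.2.2.2.2) (fun t ht => ?_) (fun t ht => (key t ht).2.2.2.2.1)
      obtain ⟨a, b, c, d, -⟩ := key t ht
      exact mem_filter.2 ⟨(memT _).2 ⟨a, b, c⟩, d⟩
    have hbottom : (T.filter KuhnBottom).card =
        ((kuhnCodes m k).filter
          (KuhnFull fun y => ψ (Fin.snoc (α := fun _ => ℕ) y 0))).card := by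
      symm
      have hvert : ∀ (x β : Fin m → ℕ) (i : ℕ), i ≤ m →
          kuhnVertex (Fin.snoc (α := fun _ => ℕ) x 0) (Fin.snoc (α := fun _ => ℕ) β m) i =
            Fin.snoc (α := fun _ => ℕ) (kuhnVertex x β i) 0 := by
        intro x β i hi
        funext c
        refine Fin.lastCases ?_ (fun c => ?_) c
        · simp [kuhnVertex]; omega
        · simp [kuhnVertex]
      have hfull : ∀ x β : Fin m → ℕ,
          KuhnFacetFull ψ (Fin.snoc (α := fun _ => ℕ) x 0, Fin.snoc (α := fun _ => ℕ) β m)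
            (m + 1) ↔ KuhnFull (fun y => ψ (Fin.snoc (α := fun _ => ℕ) y 0)) (x, β) := by
        intro x β
        constructor
        · intro h l hl
          obtain ⟨i, hi, hne, hil⟩ := h l (by omega)
          refine ⟨i, by omega, ?_⟩
          rw [← hil]
          exact congrArg ψ (hvert x β i (by omega)).symm
        · intro h l hl
          obtain ⟨i, hi, hil⟩ := h l (by omega)
          refine ⟨i, by omega, by omega, ?_⟩
          rw [← hil]
          exact congrArg ψ (hvert x β i hi)
      refine card_bij (fun p _ => ((Fin.snoc (α := fun _ => ℕ) p.1 0,
        Fin.snoc (α := fun _ => ℕ) p.2 m), m + 1)) ?_ ?_ ?_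
      · rintro ⟨x, β⟩ hp
        obtain ⟨hp, hf⟩ := mem_filter.1 hp
        obtain ⟨hx, hβ, hinj⟩ := mem_kuhnCodes.1 hp
        refine mem_filter.2 ⟨(memT _).2 ⟨mem_kuhnCodes.2 ⟨?_, ?_, ?_⟩, le_rfl,
          (hfull x β).2 hf⟩, rfl, by simp, by simp⟩
        · exact Fin.lastCases (by simp; omega) (fun c => by simpa using hx c)
        · refine Fin.lastCases (by simp) (fun c => ?_)
          have := hβ c
          simp only [Fin.snoc_castSucc] at this ⊢
          omega
        · refine Fin.lastCases (Fin.lastCases (fun _ => rfl) ?_)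
            (fun a => Fin.lastCases ?_ (fun b => ?_))
          · intro b hb
            have := hβ b
            simp at hb this
            omega
          · intro hb
            have := hβ a
            simp at hb this
            omega
          · intro hab
            simp only [Fin.snoc_castSucc] at hab
            rw [hinj hab]
      · rintro ⟨x, β⟩ _ ⟨x', β'⟩ _ h
        simp only [Prod.mk.injEq, Fin.snoc_inj] at h
        simp [h.1.1.1, h.1.2.1]
      · rintro ⟨⟨x, β⟩, j⟩ ht
        obtain ⟨ht, hj, hx0, hβm⟩ := mem_filter.1 ht
        obtain ⟨hp, -, hf⟩ := (memT _).1 ht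
        obtain ⟨hx, hβ, hinj⟩ := mem_kuhnCodes.1 hp
        simp only at hj hx0 hβm hx hβ hinj hf
        subst hj
        have ex : Fin.snoc (α := fun _ => ℕ) (fun c => x c.castSucc) 0 = x := by
          rw [← hx0]; exact Fin.snoc_init_self x
        have eβ : Fin.snoc (α := fun _ => ℕ) (fun c => β c.castSucc) m = β := by
          conv_rhs => rw [← Fin.snoc_init_self β, hβm]
          rfl
        refine ⟨(fun c => x c.castSucc, fun c => β c.castSucc), mem_filter.2
          ⟨mem_kuhnCodes.2 ⟨fun c => hx _, fun c => ?_, fun a b hab => ?_⟩, ?_⟩, ?_⟩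
        · have h1 := hβ c.castSucc
          have h2 : β c.castSucc ≠ m := fun h =>
            (Fin.castSucc_lt_last c).ne (hinj (h.trans hβm.symm))
          simp only
          omega
        · exact Fin.castSucc_injective m (hinj hab)
        · rw [← hfull, ex, eβ]
          exact hf
        · simp only [ex, eβ]
    have hsnoc : ∀ y : Fin m → ℕ, (∀ c, y c ≤ k) →
        ∀ c, Fin.snoc (α := fun _ => ℕ) y 0 c ≤ k := fun y hy =>
      Fin.lastCases (by simp) (fun c => by simpa using hy c)
    rw [hcount, ← card_filter_add_card_filter_not (s := T) KuhnBottom, Nat.cast_add, heven,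
      hbottom, add_zero]
    refine ih _ (fun y hy => ?_) (fun y hy c hc => ?_) (fun y hy c hc => ?_)
    · have := h₀ _ (hsnoc y hy) (Fin.last m) (by simp)
      simp only [Fin.val_last] at this
      omega
    · exact h₀ _ (hsnoc y hy) c.castSucc (by simpa using hc)
    · exact h₁ _ (hsnoc y hy) c.castSucc (by simpa using hc)

/-- The simplex in `(k⁻¹ℤ)^n` with a given code. -/
noncomputable def kuhnSimplex (n k : ℕ) (p : (Fin n → ℕ) × (Fin n → ℕ)) :
    Fin (n + 1) → Fin n → ℝ :=
  fun j c => (kuhnVertex p.1 p.2 j c : ℝ) / k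

lemma div_mem_combCube {n k : ℕ} (hk : 1 ≤ k) {y : Fin n → ℕ} (hy : ∀ c, y c ≤ k) :
    (fun c => (y c : ℝ) / k) ∈ combCube n k := by
  have hk' : (0 : ℝ) < k := by exact_mod_cast hk
  refine fun c => ⟨⟨by positivity, ?_⟩, y c, by simp⟩
  rw [div_le_one hk']
  exact_mod_cast hy c

lemma injOn_kuhnSimplex {n k : ℕ} (hk : 1 ≤ k) :
    Set.InjOn (kuhnSimplex n k) (kuhnCodes n k) := by
  have hk' : (k : ℝ) ≠ 0 := by positivity
  rintro ⟨x, β⟩ hp ⟨x', β'⟩ hp' h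
  obtain ⟨-, hβ, -⟩ := mem_kuhnCodes.1 hp
  obtain ⟨-, hβ', -⟩ := mem_kuhnCodes.1 hp'
  simp only at hβ hβ'
  have hv : ∀ j ≤ n, ∀ c, kuhnVertex x β j c = kuhnVertex x' β' j c := by
    intro j hj c
    have := congrFun (congrFun h ⟨j, by omega⟩) c
    simp only [kuhnSimplex] at this
    rw [div_left_inj' hk'] at this
    exact_mod_cast this
  have hx : x = x' := by
    funext c
    simpa [kuhnVertex] using hv 0 (by omega) c
  subst hx
  have hβe : β = β' := by
    funext c
    have h1 := hv (β c) (hβ c).le c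
    have h2 := hv (β' c) (hβ' c).le c
    simp only [kuhnVertex] at h1 h2
    split_ifs at h1 h2 <;> omega
  rw [hβe]

lemma isNSimplex_kuhnSimplex {n k : ℕ} {p : (Fin n → ℕ) × (Fin n → ℕ)}
    (hp : p ∈ kuhnCodes n k) : IsNSimplex n k (kuhnSimplex n k p) := by
  obtain ⟨-, hβ, hinj⟩ := mem_kuhnCodes.1 hp
  refine ⟨fun j c => ⟨kuhnVertex p.1 p.2 j c, by simp [kuhnSimplex]⟩, ?_⟩
  have hb : Function.Bijective fun c => (⟨p.2 c, hβ c⟩ : Fin n) :=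
    Finite.injective_iff_bijective.1 fun a b hab => hinj (by simpa using hab)
  set e := Equiv.ofBijective _ hb
  have he : ∀ c, (e c).val = p.2 c := fun c => rfl
  refine ⟨e.symm, fun j => ?_⟩
  funext c
  simp only [kuhnSimplex, kuhnVertex, stdVec, Pi.add_apply, Fin.val_succ, Fin.val_castSucc,
    Equiv.eq_symm_apply, Fin.ext_iff, he]
  rcases lt_trichotomy (p.2 c) j.val with h | h | h
  · rw [if_pos (by omega), if_pos h, if_neg (by omega), add_zero]
  · rw [if_pos (by omega), if_neg (by omega), if_pos h]
    push_cast
    ring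
  · rw [if_neg (by omega), if_neg (by omega), if_neg (by omega), add_zero, add_zero]

lemma exists_kuhnSimplex_eq {n k : ℕ} (hk : 1 ≤ k) {z : Fin (n + 1) → Fin n → ℝ}
    (hz : IsNSimplex n k z) (hc : Set.range z ⊆ combCube n k) :
    ∃ p ∈ kuhnCodes n k, kuhnSimplex n k p = z := by
  have hk' : (0 : ℝ) < k := by exact_mod_cast hk
  obtain ⟨hlat, α, hα⟩ := hz
  have hx : ∀ c, ∃ a : ℕ, z 0 c = (a : ℝ) / k := by
    intro c
    obtain ⟨a, ha⟩ := hlat 0 c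
    have h0 := (hc ⟨0, rfl⟩ c).1.1
    rw [ha, le_div_iff₀ hk', zero_mul] at h0
    lift a to ℕ using by exact_mod_cast h0
    exact ⟨a, by simpa using ha⟩
  choose x hx using hx
  have heq : kuhnSimplex n k (x, fun c => (α.symm c).val) = z := by
    funext j
    induction j using Fin.induction with
    | zero => funext c; simp [kuhnSimplex, kuhnVertex, hx]
    | succ j ih =>
      rw [hα, ← ih]
      funext c
      simp only [kuhnSimplex, kuhnVertex, stdVec, Pi.add_apply, Fin.val_succ, Fin.val_castSucc,
        ← Equiv.symm_apply_eq, Fin.ext_iff]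
      rcases lt_trichotomy (α.symm c).val j.val with h | h | h
      · rw [if_pos (by omega), if_pos h, if_neg (by omega), add_zero]
      · rw [if_pos (by omega), if_neg (by omega), if_pos h]
        push_cast
        ring
      · rw [if_neg (by omega), if_neg (by omega), if_neg (by omega), add_zero, add_zero]
  refine ⟨_, mem_kuhnCodes.2 ⟨fun c => ?_, fun c => (α.symm c).isLt, fun a b hab =>
    α.symm.injective (Fin.ext hab)⟩, heq⟩
  have h1 := (hc ⟨Fin.last n, rfl⟩ c).1.2
  rw [← heq, kuhnSimplex, div_le_one hk'] at h1
  have h2 : kuhnVertex x (fun c => (α.symm c).val) n c ≤ k := by exact_mod_cast h1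
  simp only [kuhnVertex, (α.symm c).isLt, if_true] at h2
  simp only
  omega

/-- If `φ : C(k) → {0,…,n}` satisfies the Sperner boundary conditions
(i) `x ∈ C_i^-(k) ⇒ φ(x) < i` and (ii) `x ∈ C_i^+(k) ⇒ φ(x) ≠ i-1`
(faces indexed by `i = 1,…,n`; here `i : Fin n` stands for the index `i+1`),
then the number of full `n`-simplices `S ⊆ C(k)`, i.e. those with `φ(S) = {0,…,n}`, is odd. -/
theorem card_full_simplices_odd (n k : ℕ) (hk : 1 ≤ k)
    (φ : (Fin n → ℝ) → ℕ) (hφ : ∀ x ∈ combCube n k, φ x ≤ n)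
    (hminus : ∀ x ∈ combCube n k, ∀ i : Fin n, x i = 0 → φ x < i.val + 1)
    (hplus : ∀ x ∈ combCube n k, ∀ i : Fin n, x i = 1 → φ x ≠ i.val) :
    Odd (Set.ncard {z : Fin (n + 1) → Fin n → ℝ |
      IsNSimplex n k z ∧ Set.range z ⊆ combCube n k ∧
        φ '' Set.range z = {m : ℕ | m ≤ n}}) := by
  classical
  set ψ : (Fin n → ℕ) → ℕ := fun y => φ fun c => (y c : ℝ) / k with hψ
  have hk' : (k : ℝ) ≠ 0 := by positivity
  have hset : {z : Fin (n + 1) → Fin n → ℝ | IsNSimplex n k z ∧ Set.range z ⊆ combCube n k ∧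
      φ '' Set.range z = {m : ℕ | m ≤ n}} =
        kuhnSimplex n k '' ((kuhnCodes n k).filter (KuhnFull ψ)) := by
    ext z
    simp only [Set.mem_ofPred_eq, Set.mem_image, Finset.mem_coe, Finset.mem_filter]
    constructor
    · rintro ⟨hz, hc, hf⟩
      obtain ⟨p, hp, rfl⟩ := exists_kuhnSimplex_eq hk hz hc
      refine ⟨p, ⟨hp, fun l hl => ?_⟩, rfl⟩
      have hl' : l ∈ {m : ℕ | m ≤ n} := hl
      rw [← hf] at hl'
      obtain ⟨_, ⟨j, rfl⟩, hj⟩ := hl'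
      exact ⟨j, Nat.lt_succ_iff.1 j.isLt, hj⟩
    · rintro ⟨p, ⟨hp, hf⟩, rfl⟩
      have hmem : Set.range (kuhnSimplex n k p) ⊆ combCube n k := by
        rintro _ ⟨j, rfl⟩
        exact div_mem_combCube hk (kuhnVertex_le hp j)
      refine ⟨isNSimplex_kuhnSimplex hp, hmem, Set.Subset.antisymm ?_ ?_⟩
      · rintro _ ⟨y, hy, rfl⟩
        exact hφ y (hmem hy)
      · intro l hl
        obtain ⟨i, hi, hil⟩ := hf l hl
        exact ⟨_, ⟨⟨i, Nat.lt_succ_iff.2 hi⟩, rfl⟩, hil⟩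
  rw [hset, Set.InjOn.ncard_image
    ((injOn_kuhnSimplex hk).mono (Finset.coe_subset.2 (Finset.filter_subset _ _))),
    Set.ncard_coe_finset, ← ZMod.natCast_eq_one_iff_odd]
  refine odd_card_kuhnFull n k hk ψ (fun y hy => hφ _ (div_mem_combCube hk hy))
    (fun y hy c hc => hminus _ (div_mem_combCube hk hy) c (by simp [hc]))
    (fun y hy c hc => hplus _ (div_mem_combCube hk hy) c (by simp [hc, hk']))
end

section
/- Let n ≥ 1, let φ : C(k) → {0,1,…,n} satisfy (i) x ∈ C_i^-(k) ⇒ φ(x) < i and (ii) x ∈ C_i^+(k) ⇒ φ(x) ≠ i−1, and let S be an n-simplex in C(k). Then: if S is full, exactly one of its n faces F_i(S) (i ∈ {0,…,n}) is a full (n−1)-face; if S is not full and {0,…,n−1} ⊄ φ(S), then no face of S is full; and if φ(S) = {0,…,n−1}, then exactly two faces of S are full. -/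
theorem sum_stdVec (n k : ℕ) (i : Fin n) : ∑ j, stdVec n k i j = (1 : ℝ) / k := by
  simp [stdVec]

theorem IsNSimplex.injective {n k : ℕ} (hk : 1 ≤ k) {z : Fin (n + 1) → Fin n → ℝ}
    (hz : IsNSimplex n k z) : Function.Injective z := by
  obtain ⟨-, α, hα⟩ := hz
  have hmono : StrictMono fun j => ∑ i, z j i := by
    refine Fin.strictMono_iff_lt_succ.2 fun j => ?_
    have hk' : (0 : ℝ) < 1 / k := by positivity
    simp only [hα j, Pi.add_apply, Finset.sum_add_distrib, sum_stdVec]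
    linarith
  exact fun a b hab => hmono.injective (by simp only [hab])

theorem ncard_setOf_lt (n : ℕ) : {m : ℕ | m < n}.ncard = n := by
  rw [show {m : ℕ | m < n} = (Finset.range n : Set ℕ) by ext; simp, Set.ncard_coe_finset,
    Finset.card_range]

/-- A map from `n + 1` points onto `{0,…,n}` has exactly one point whose removal leaves
the image `{0,…,n-1}`. -/
theorem existsUnique_image_compl_of_range_eq {n : ℕ} {f : Fin (n + 1) → ℕ}
    (hf : Set.range f = {m | m ≤ n}) : ∃! i, f '' {i}ᶜ = {m | m < n} := by
  have hinj : Function.Injective f := by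
    rw [← Set.injOn_univ]
    refine Set.injOn_of_ncard_image_eq ?_
    rw [Set.image_univ, hf, Set.ncard_univ, Nat.card_fin]
    simpa only [Nat.lt_succ_iff] using ncard_setOf_lt (n + 1)
  obtain ⟨i, hi⟩ : n ∈ Set.range f := by simp [hf]
  refine ⟨i, ?_, fun l hl => ?_⟩
  · show f '' {i}ᶜ = {m | m < n}
    rw [Set.image_compl_eq_range_sdiff_image hinj, hf, Set.image_singleton, hi]
    ext m
    simp [lt_iff_le_and_ne]
  · by_contra hne
    have hmem : f i ∈ f '' {l}ᶜ := Set.mem_image_of_mem f (Ne.symm hne)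
    simp [hl, hi] at hmem

theorem image_sdiff_singleton_eq_of_eq {ι β : Type*} {f : ι → β} {i j : ι} {s : Set ι}
    (hij : i ≠ j) (hf : f i = f j) (hj : j ∈ s) : f '' (s \ {i}) = f '' s := by
  refine (Set.image_mono Set.sdiff_subset).antisymm ?_
  rintro _ ⟨a, ha, rfl⟩
  by_cases h : a = i
  · exact ⟨j, ⟨hj, Ne.symm hij⟩, by rw [h, hf]⟩
  · exact ⟨a, ⟨ha, h⟩, rfl⟩

/-- A map from `n + 1` points onto `{0,…,n-1}` has exactly two points whose removal leaves
the image unchanged. -/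
theorem exists_pair_image_compl_of_range_eq {n : ℕ} {f : Fin (n + 1) → ℕ}
    (hf : Set.range f = {m | m < n}) :
    ∃ i j, i ≠ j ∧ f '' {i}ᶜ = {m | m < n} ∧ f '' {j}ᶜ = {m | m < n} ∧
      ∀ l, f '' {l}ᶜ = {m | m < n} → l = i ∨ l = j := by
  obtain ⟨i, j, hfij, hij⟩ : ∃ i j, f i = f j ∧ i ≠ j := by
    by_contra! hinj
    have hcard := Set.ncard_image_of_injective Set.univ (f := f) fun a b => hinj a b
    rw [Set.image_univ, hf, ncard_setOf_lt, Set.ncard_univ, Nat.card_fin] at hcard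
    omega
  have huniv (a b) (hab : a ≠ b) (h : f a = f b) : f '' {a}ᶜ = {m | m < n} := by
    rw [Set.compl_eq_univ_sdiff, image_sdiff_singleton_eq_of_eq hab h (Set.mem_univ b),
      Set.image_univ, hf]
  refine ⟨i, j, hij, huniv i j hij hfij, huniv j i hij.symm hfij.symm, fun l hl => ?_⟩
  by_contra! hne
  have hj : j ∈ ({l}ᶜ : Set (Fin (n + 1))) := hne.2.symm
  have hi : i ∈ ({l}ᶜ : Set (Fin (n + 1))) := hne.1.symm
  have himage := image_sdiff_singleton_eq_of_eq hij hfij hj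
  have hle := Set.ncard_image_le (f := f) (Set.toFinite ({l}ᶜ \ {i}))
  have hlt := Set.ncard_sdiff_singleton_lt_of_mem hi
  have hcard := Set.ncard_add_ncard_compl ({l} : Set (Fin (n + 1)))
  rw [himage, hl, ncard_setOf_lt] at hle
  rw [Set.ncard_singleton, Nat.card_fin] at hcard
  omega

/-- Let `φ : C(k) → {0,…,n}` satisfy the Sperner boundary conditions, and let
`S = [z_0,…,z_n]` be an `n`-simplex in `C(k)`, with `i`-th face `F_i(S) = S \ {z_i}`.
`S` is full if `φ(S) = {0,…,n}`; an `(n-1)`-face `F` is full if `φ(F) = {0,…,n-1}`. Then: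
if `S` is full, exactly one face of `S` is full; if `S` is not full and
`{0,…,n-1} ⊄ φ(S)`, no face is full; and if `φ(S) = {0,…,n-1}`, exactly two faces are full. -/
theorem full_faces_count (n k : ℕ) (hn : 1 ≤ n) (hk : 1 ≤ k)
    (φ : (Fin n → ℝ) → ℕ) (hφ : ∀ x ∈ combCube n k, φ x ≤ n)
    (hminus : ∀ x ∈ combCube n k, ∀ i : Fin n, x i = 0 → φ x < i.val + 1)
    (hplus : ∀ x ∈ combCube n k, ∀ i : Fin n, x i = 1 → φ x ≠ i.val)
    (z : Fin (n + 1) → Fin n → ℝ) (hz : IsNSimplex n k z)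
    (hzC : Set.range z ⊆ combCube n k) :
    (φ '' Set.range z = {m : ℕ | m ≤ n} →
      ∃! i : Fin (n + 1), φ '' (Set.range z \ {z i}) = {m : ℕ | m < n}) ∧
    (φ '' Set.range z ≠ {m : ℕ | m ≤ n} → ¬ {m : ℕ | m < n} ⊆ φ '' Set.range z →
      ∀ i : Fin (n + 1), φ '' (Set.range z \ {z i}) ≠ {m : ℕ | m < n}) ∧
    (φ '' Set.range z = {m : ℕ | m < n} →
      ∃ i j : Fin (n + 1), i ≠ j ∧
        φ '' (Set.range z \ {z i}) = {m : ℕ | m < n} ∧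
        φ '' (Set.range z \ {z j}) = {m : ℕ | m < n} ∧
        ∀ l : Fin (n + 1), φ '' (Set.range z \ {z l}) = {m : ℕ | m < n} → l = i ∨ l = j) := by
  have hinj := hz.injective hk
  have hface (i) : φ '' (Set.range z \ {z i}) = (φ ∘ z) '' {i}ᶜ := by
    rw [Set.image_comp, Set.image_compl_eq_range_sdiff_image hinj, Set.image_singleton]
  refine ⟨fun hfull => ?_, fun _ hnot i hi => ?_, fun halmost => ?_⟩
  · simp only [hface]
    exact existsUnique_image_compl_of_range_eq (by rw [Set.range_comp, hfull])
  · exact hnot (hi ▸ Set.image_mono Set.sdiff_subset)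
  · simp only [hface]
    exact exists_pair_image_compl_of_range_eq (by rw [Set.range_comp, halmost])
end

section
/- Whenever C_1,…,C_n ⊆ [0,1]^n are closed sets such that C_i separates the opposite faces I_i^- and I_i^+ for each i = 1,…,n, then ∩_{i=1}^n C_i ≠ ∅. -/
/-- `C` separates `A` and `B` in the space `X`: the complement of `C` is the union of two
disjoint open sets `U`, `V` with `A ⊆ U` and `B ⊆ V`. -/
def Separates {X : Type*} [TopologicalSpace X] (A B C : Set X) : Prop :=
  ∃ U V : Set X, IsOpen U ∧ IsOpen V ∧ Disjoint U V ∧ A ⊆ U ∧ B ⊆ V ∧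
    Set.univ \ C = U ∪ V

open Finset in
/-- The mod 2 simplicial cup product `df_{i₁} ∪ ⋯ ∪ df_{iₖ}`, for `L = [i₁, …, iₖ]`, evaluated on
the Freudenthal triangulation of the unit lattice cube with least vertex `x` and edge
directions `D`. -/
def cubeCup {ι : Type*} [DecidableEq ι] (f : ι → (ι → ℕ) → ZMod 2) :
    List ι → (ι → ℕ) → Finset ι → ZMod 2
  | [], _, _ => 1
  | i :: L, x, D =>
      ∑ j ∈ D, (f i (x + Pi.single j 1) - f i x) * cubeCup f L (x + Pi.single j 1) (D.erase j)

section CubeCup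

open Finset

variable {ι : Type*} [DecidableEq ι]

/-- A sum of a symmetric function over ordered pairs of distinct elements vanishes mod 2. -/
theorem sum_sum_erase_eq_zero_of_symm (D : Finset ι) (F : ι → ι → ZMod 2)
    (hF : ∀ j k, F j k = F k j) : ∑ j ∈ D, ∑ k ∈ D.erase j, F j k = 0 := by
  rw [Finset.sum_sigma']
  refine Finset.sum_involution (fun p _ => ⟨p.2, p.1⟩) ?_ ?_ ?_ ?_
  · rintro ⟨j, k⟩ _
    simp only [hF k j]
    exact CharTwo.add_self_eq_zero _
  · rintro ⟨j, k⟩ h _ he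
    simp only [mem_sigma, mem_erase] at h
    simp only [Sigma.mk.injEq] at he
    exact h.2.1 he.1
  · rintro ⟨j, k⟩ h
    simp only [mem_sigma, mem_erase] at h ⊢
    exact ⟨h.2.2, Ne.symm h.2.1, h.1⟩
  · rintro ⟨j, k⟩ _
    rfl

/-- The cup product cochain is closed. -/
theorem sum_cubeCup_add_single (f : ι → (ι → ℕ) → ZMod 2) (L : List ι) (x : ι → ℕ)
    (D : Finset ι) :
    ∑ j ∈ D, cubeCup f L (x + Pi.single j 1) (D.erase j) =
      ∑ j ∈ D, cubeCup f L x (D.erase j) := by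
  induction L generalizing x D with
  | nil => simp [cubeCup]
  | cons i L ih =>
    have hpair (g : (ι → ℕ) → ZMod 2) :
        ∑ j ∈ D, ∑ k ∈ D.erase j, g (x + Pi.single j 1 + Pi.single k 1) *
          cubeCup f L (x + Pi.single j 1 + Pi.single k 1) ((D.erase j).erase k) = 0 := by
      refine sum_sum_erase_eq_zero_of_symm D _ fun j k => ?_
      rw [erase_right_comm, add_right_comm]
    have hone : ∑ j ∈ D, ∑ k ∈ D.erase j,
        cubeCup f L (x + Pi.single j 1) ((D.erase j).erase k) = 0 := by
      rw [← hpair fun _ => 1]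
      refine sum_congr rfl fun j _ => ?_
      simp only [one_mul]
      exact (ih _ _).symm
    have hswap (G : ι → ι → ZMod 2) :
        ∑ j ∈ D, ∑ k ∈ D.erase j, G j k = ∑ j ∈ D, ∑ k ∈ D.erase j, G k j := by
      rw [← sub_eq_zero, CharTwo.sub_eq_add, ← sum_add_distrib]
      simp only [← sum_add_distrib]
      exact sum_sum_erase_eq_zero_of_symm D (fun j k => G j k + G k j)
        fun j k => add_comm _ _
    have hleft : ∑ j ∈ D, cubeCup f (i :: L) (x + Pi.single j 1) (D.erase j) =
        - ∑ j ∈ D, f i (x + Pi.single j 1) *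
          ∑ k ∈ D.erase j, cubeCup f L (x + Pi.single j 1) ((D.erase j).erase k) := by
      simp only [cubeCup, sub_mul, sum_sub_distrib]
      rw [hpair (f i), zero_sub]
      simp only [← mul_sum]
      congr 1
      exact sum_congr rfl fun j _ => by rw [ih]
    have hright : ∑ j ∈ D, cubeCup f (i :: L) x (D.erase j) =
        ∑ j ∈ D, f i (x + Pi.single j 1) *
          ∑ k ∈ D.erase j, cubeCup f L (x + Pi.single j 1) ((D.erase j).erase k) := by
      simp only [cubeCup]
      rw [hswap]
      simp only [erase_right_comm (s := D), sub_mul, sum_sub_distrib, ← mul_sum]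
      rw [sub_eq_self, hone, mul_zero]
    rw [hleft, hright, CharTwo.neg_eq]

/-- The cup product with first factor `df_i` is the coboundary of `f_i` times the rest. -/
theorem cubeCup_cons (f : ι → (ι → ℕ) → ZMod 2) (i : ι) (L : List ι) (x : ι → ℕ)
    (D : Finset ι) :
    cubeCup f (i :: L) x D =
      ∑ j ∈ D, (f i (x + Pi.single j 1) * cubeCup f L (x + Pi.single j 1) (D.erase j) -
        f i x * cubeCup f L x (D.erase j)) := by
  simp only [cubeCup, sub_mul, sum_sub_distrib, ← mul_sum, sum_cubeCup_add_single]

/-- If the cup product does not vanish on a cube, each of its factors is nonconstant there. -/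
theorem exists_ne_of_cubeCup_ne_zero (f : ι → (ι → ℕ) → ZMod 2) {L : List ι} {x : ι → ℕ}
    {D : Finset ι} (h : cubeCup f L x D ≠ 0) {i : ι} (hi : i ∈ L) :
    ∃ y z : ι → ℕ, (∀ k, x k ≤ y k ∧ y k ≤ x k + if k ∈ D then 1 else 0) ∧
      (∀ k, x k ≤ z k ∧ z k ≤ x k + if k ∈ D then 1 else 0) ∧ f i y ≠ f i z := by
  induction L generalizing x D with
  | nil => simp at hi
  | cons l L ih =>
    obtain ⟨j, hj, hne⟩ := exists_ne_zero_of_sum_ne_zero h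
    rcases List.mem_cons.1 hi with rfl | hi
    · refine ⟨x + Pi.single j 1, x, fun k => ?_, fun k => by simp,
        sub_ne_zero.1 (left_ne_zero_of_mul hne)⟩
      by_cases hk : k = j
      · subst hk; simp [hj]
      · simp [hk]
    · have hstep (w : ι → ℕ) (hw : ∀ k, (x + Pi.single j 1 : ι → ℕ) k ≤ w k ∧
          w k ≤ (x + Pi.single j 1 : ι → ℕ) k + if k ∈ D.erase j then 1 else 0) (k : ι) :
          x k ≤ w k ∧ w k ≤ x k + if k ∈ D then 1 else 0 := by
        have := hw k
        by_cases hk : k = j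
        · subst hk; simp [hj] at this ⊢; omega
        · simpa [hk] using this
      obtain ⟨y, z, hy, hz, hyz⟩ := ih (right_ne_zero_of_mul hne) hi
      exact ⟨y, z, hstep y hy, hstep z hz, hyz⟩

variable [Fintype ι]

/-- The least vertices of the unit cubes in the face of the grid `{0, …, N}^ι` that is spanned
by the directions `D` and contains the top vertex. -/
def gridFace (N : ℕ) (D : Finset ι) : Finset (ι → ℕ) :=
  Fintype.piFinset fun j => if j ∈ D then range N else {N}

/-- Telescoping along one direction of a grid. -/
theorem sum_gridFace_sub (N : ℕ) {D : Finset ι} {j : ι} (hj : j ∈ D) (h : (ι → ℕ) → ZMod 2) :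
    ∑ x ∈ gridFace N D, (h (x + Pi.single j 1) - h x) =
      ∑ y ∈ gridFace N (D.erase j), (h y - h (Function.update y j 0)) := by
  have hmem (y) (hy : y ∈ gridFace N (D.erase j)) : y j = N := by
    simpa using Fintype.mem_piFinset.1 hy j
  have key : ∑ x ∈ gridFace N D, (h (x + Pi.single j 1) - h x) =
      ∑ p ∈ gridFace N (D.erase j) ×ˢ range N,
        (h (Function.update p.1 j (p.2 + 1)) - h (Function.update p.1 j p.2)) := by
    refine sum_nbij' (fun x => (Function.update x j N, x j))
      (fun p => Function.update p.1 j p.2) ?_ ?_ ?_ ?_ ?_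
    · intro x hx
      simp only [gridFace, Fintype.mem_piFinset, mem_product] at hx ⊢
      refine ⟨fun k => ?_, by simpa [hj] using hx j⟩
      by_cases hk : k = j
      · subst hk; simp
      · simpa [hk] using hx k
    · rintro ⟨y, m⟩ hp
      simp only [gridFace, Fintype.mem_piFinset, mem_product] at hp ⊢
      intro k
      by_cases hk : k = j
      · subst hk; simpa [hj] using hp.2
      · simpa [hk] using hp.1 k
    · intro x _
      simp
    · rintro ⟨y, m⟩ hp
      have := hmem y (mem_product.1 hp).1
      simp [← this]
    · intro x _
      have : x + Pi.single j 1 = Function.update x j (x j + 1) := by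
        ext k
        by_cases hk : k = j
        · subst hk; simp
        · simp [hk]
      simp [this]
  rw [key, sum_product]
  refine sum_congr rfl fun y hy => ?_
  rw [sum_range_sub (fun m => h (Function.update y j m))]
  simp [← hmem y hy]

/-- The total cup product over the grid is the product of the degrees in each direction. -/
theorem sum_cubeCup_gridFace (f : ι → (ι → ℕ) → ZMod 2) (N : ℕ)
    (hzero : ∀ i x, x i = 0 → f i x = 0) (hone : ∀ i x, x i = N → f i x = 1)
    (L : List ι) (hL : L.Nodup) :
    ∑ x ∈ gridFace N L.toFinset, cubeCup f L x L.toFinset = 1 := by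
  induction L with
  | nil => simp [gridFace, cubeCup]
  | cons i L ih =>
    obtain ⟨hiL, hL⟩ := List.nodup_cons.1 hL
    have hvanish (j : ι) (hj : j ∈ L) (D : Finset ι) (x : ι → ℕ) (hjD : j ∉ D)
        (hx : x j = 0 ∨ x j = N) : cubeCup f L x D = 0 := by
      by_contra h
      obtain ⟨y, z, hy, hz, hyz⟩ := exists_ne_of_cubeCup_ne_zero f h hj
      have hy' : y j = x j := by have := hy j; simp [hjD] at this; omega
      have hz' : z j = x j := by have := hz j; simp [hjD] at this; omega
      rcases hx with hx | hx
      · exact hyz (by rw [hzero j y (hy'.trans hx), hzero j z (hz'.trans hx)])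
      · exact hyz (by rw [hone j y (hy'.trans hx), hone j z (hz'.trans hx)])
    have hmem (D : Finset ι) (j) (y) (hy : y ∈ gridFace N (D.erase j)) : y j = N := by
      simpa using Fintype.mem_piFinset.1 hy j
    simp only [cubeCup_cons]
    rw [sum_comm, sum_eq_single i]
    · rw [sum_gridFace_sub N (by simp)
        (fun x => f i x * cubeCup f L x ((i :: L).toFinset.erase i))]
      have he : (i :: L).toFinset.erase i = L.toFinset := by
        rw [List.toFinset_cons, erase_insert (by simpa using hiL)]
      rw [← ih hL]
      refine (sum_congr rfl fun y hy => ?_).trans (by rw [he])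
      rw [hone i y (hmem _ _ _ hy), hzero i _ (Function.update_self ..), he]
      ring
    · intro j hj hji
      have hjL : j ∈ L := by simpa [hji] using hj
      rw [sum_gridFace_sub N hj
        (fun x => f i x * cubeCup f L x ((i :: L).toFinset.erase j))]
      refine sum_eq_zero fun y hy => ?_
      rw [hvanish j hjL _ y (by simp) (.inr (hmem _ _ _ hy)),
        hvanish j hjL _ (Function.update y j 0) (by simp) (.inl (by simp))]
      ring
    · simp

/-- A cubical Sperner lemma (Kuhn): if each `P i` holds on the bottom `i`-face of a grid and
fails on the top one, then some unit cube has, for every `i`, vertices of both kinds. -/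
theorem exists_cube_of_grid_faces (N : ℕ) (P : ι → (ι → ℕ) → Prop)
    (hbot : ∀ i x, x i = 0 → P i x) (htop : ∀ i x, x i = N → ¬ P i x) :
    ∃ x : ι → ℕ, ∀ i, ∃ y z : ι → ℕ, (∀ k, x k ≤ y k ∧ y k ≤ x k + 1) ∧
      (∀ k, x k ≤ z k ∧ z k ≤ x k + 1) ∧ P i y ∧ ¬ P i z := by
  classical
  let f : ι → (ι → ℕ) → ZMod 2 := fun i x => if P i x then 0 else 1
  have hsum := sum_cubeCup_gridFace f N (fun i x h => if_pos (hbot i x h))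
    (fun i x h => if_neg (htop i x h)) (univ : Finset ι).toList (nodup_toList _)
  obtain ⟨x, -, hx⟩ := exists_ne_zero_of_sum_ne_zero (hsum.trans_ne one_ne_zero)
  refine ⟨x, fun i => ?_⟩
  obtain ⟨y, z, hy, hz, hyz⟩ := exists_ne_of_cubeCup_ne_zero f hx (i := i) (by simp)
  simp only [toList_toFinset, mem_univ, if_true] at hy hz
  by_cases hPy : P i y
  · exact ⟨y, z, hy, hz, hPy, fun hPz => hyz (by simp [f, hPy, hPz])⟩
  · exact ⟨z, y, hz, hy, by_contra fun hPz => hyz (by simp [f, hPy, hPz]), hPy⟩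

end CubeCup

/-- The point of the unit cube with coordinates `y i / N`, truncated to `[0, 1]`. -/
noncomputable def gridPoint {ι : Type*} (N : ℕ) (y : ι → ℕ) : ι → unitInterval :=
  fun i => Set.projIcc (0 : ℝ) 1 zero_le_one (y i / N)

theorem dist_gridPoint_le {ι : Type*} [Fintype ι] (N : ℕ) {x y : ι → ℕ}
    (h : ∀ k, x k ≤ y k ∧ y k ≤ x k + 1) :
    dist (gridPoint N x) (gridPoint N y) ≤ 1 / N := by
  refine (dist_pi_le_iff (by positivity)).2 fun k => ?_
  have hxy : (x k : ℝ) ≤ y k := by exact_mod_cast (h k).1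
  have hyx : (y k : ℝ) ≤ x k + 1 := by exact_mod_cast (h k).2
  have hproj := (LipschitzWith.projIcc (zero_le_one (α := ℝ))).dist_le_mul
    ((x k : ℝ) / N) (y k / N)
  refine hproj.trans ?_
  rw [NNReal.coe_one, one_mul, Real.dist_eq, abs_sub_comm, ← sub_div, abs_div, Nat.abs_cast]
  gcongr
  rw [abs_le]
  constructor <;> linarith

open Filter Topology in
/-- In the unit cube, sets `U i` containing the `i`-th bottom face and disjoint from the `i`-th
top face have a common point in all closures `closure (U i)` and `closure (U i)ᶜ`. -/
theorem exists_forall_mem_closure_inter_closure_compl {ι : Type*} [Fintype ι]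
    (U : ι → Set (ι → unitInterval)) (hbot : ∀ i x, x i = 0 → x ∈ U i)
    (htop : ∀ i x, x i = 1 → x ∉ U i) :
    ∃ p, ∀ i, p ∈ closure (U i) ∧ p ∈ closure (U i)ᶜ := by
  classical
  have hgrid (m : ℕ) := exists_cube_of_grid_faces (m + 1) (fun i y => gridPoint (m + 1) y ∈ U i)
    (fun i x hx => hbot i _ (by simp [gridPoint, hx]))
    (fun i x hx => htop i _ (by
      have hm : ((m : ℝ) + 1) ≠ 0 := by positivity
      simp [gridPoint, hx, hm]))
  choose x y z hy hz hyU hzU using hgrid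
  obtain ⟨p, φ, hφ, hp⟩ := CompactSpace.tendsto_subseq fun m => gridPoint (m + 1) (x m)
  have hlim (w : ℕ → ι → ℕ) (hw : ∀ m k, x m k ≤ w m k ∧ w m k ≤ x m k + 1) :
      Tendsto (fun m => gridPoint (φ m + 1) (w (φ m))) atTop (𝓝 p) := by
    refine hp.congr_dist (squeeze_zero (fun _ => dist_nonneg)
      (fun m => dist_gridPoint_le (φ m + 1) (hw (φ m))) ?_)
    have := (tendsto_one_div_add_atTop_nhds_zero_nat (𝕜 := ℝ)).comp hφ.tendsto_atTop
    simpa [Function.comp_def] using this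
  refine ⟨p, fun i => ⟨?_, ?_⟩⟩
  · exact mem_closure_of_tendsto (hlim (fun m => y m i) fun m => hy m i)
      (Eventually.of_forall fun m => hyU (φ m) i)
  · exact mem_closure_of_tendsto (hlim (fun m => z m i) fun m => hz m i)
      (Eventually.of_forall fun m => hzU (φ m) i)

/-- Whenever `C_1,…,C_n ⊆ [0,1]^n` are closed sets such that `C_i` separates the opposite
faces `I_i^- = {x : x_i = 0}` and `I_i^+ = {x : x_i = 1}` for each `i`, then `⋂_i C_i ≠ ∅`. -/
theorem iInter_nonempty_of_separates_faces (n : ℕ) (hn : 1 ≤ n)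
    (C : Fin n → Set (Fin n → unitInterval)) (hC : ∀ i, IsClosed (C i))
    (hsep : ∀ i : Fin n,
      Separates {x : Fin n → unitInterval | x i = 0}
        {x : Fin n → unitInterval | x i = 1} (C i)) :
    (⋂ i, C i).Nonempty := by
  choose U V hU hV hUV hbot htop hcompl using hsep
  obtain ⟨p, hp⟩ := exists_forall_mem_closure_inter_closure_compl U
    (fun i x hx => hbot i hx)
    (fun i x hx hxU => Set.disjoint_left.1 (hUV i) hxU (htop i hx))
  refine ⟨p, Set.mem_iInter.2 fun i => by_contra fun hpC => ?_⟩
  have hpUV : p ∈ U i ∪ V i := hcompl i ▸ ⟨Set.mem_univ p, hpC⟩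
  rcases hpUV with hpU | hpV
  · have := (hp i).2
    rw [(hU i).isClosed_compl.closure_eq] at this
    exact this hpU
  · exact Set.disjoint_left.1 ((hUV i).closure_left (hV i)) (hp i).1 hpV
end
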